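/- arXiv:1806.07297 — 3 statements merged into one kernel-verified Lean document; each statement's English description precedes it below -/
import Mathlib

section
/- Let N₁, N₂, N₃, R be positive integers, let X ∈ ℝ^{N₁×N₂×N₃} be a tensor such that U_R(X) is nonempty, let p ≥ 1 and α > 0. Then the infimum over u ∈ U_R(X) of (1/3)·Σ_{r=1}^R Σ_{d=1}^3 ‖u_r^{(d)}‖_p^α equals the infimum over u ∈ U_R(X) of Σ_{r=1}^R (‖u_r^{(1)}‖_p · ‖u_r^{(2)}‖_p · ‖u_r^{(3)}‖_p)^{α/3}. -/
open Finset

/-- The vector ℓ_p norm on `ℝ^n`. -/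
noncomputable def vecLpNorm (p : ℝ) {n : ℕ} (v : Fin n → ℝ) : ℝ :=
  (∑ i, |v i| ^ p) ^ (1 / p)

/-- `u = (u1, u2, u3)` is a rank-`R` CP decomposition of the tensor `X`. -/
def IsCPDecomp {N₁ N₂ N₃ R : ℕ} (X : Fin N₁ × Fin N₂ × Fin N₃ → ℝ)
    (u1 : Fin R → Fin N₁ → ℝ) (u2 : Fin R → Fin N₂ → ℝ)
    (u3 : Fin R → Fin N₃ → ℝ) : Prop :=
  ∀ i j k, X (i, j, k) = ∑ r, u1 r i * u2 r j * u3 r k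

theorem vecLpNorm_nonneg (p : ℝ) {n : ℕ} (v : Fin n → ℝ) : 0 ≤ vecLpNorm p v := by
  unfold vecLpNorm
  positivity

theorem vecLpNorm_zero {p : ℝ} (hp : 1 ≤ p) {n : ℕ} : vecLpNorm p (0 : Fin n → ℝ) = 0 := by
  have hp0 : p ≠ 0 := by positivity
  simp [vecLpNorm, Real.zero_rpow hp0, Real.zero_rpow (inv_ne_zero hp0)]

theorem eq_zero_of_vecLpNorm_eq_zero {p : ℝ} (hp : 1 ≤ p) {n : ℕ} {v : Fin n → ℝ}
    (hv : vecLpNorm p v = 0) : v = 0 := by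
  have hp0 : p ≠ 0 := by positivity
  have hsum : ∑ i, |v i| ^ p = 0 :=
    (Real.rpow_eq_zero (Finset.sum_nonneg fun i _ => by positivity) (one_div_ne_zero hp0)).1 hv
  funext i
  have hi := (Finset.sum_eq_zero_iff_of_nonneg fun i _ => by positivity).1 hsum i
    (Finset.mem_univ i)
  exact abs_eq_zero.1 ((Real.rpow_eq_zero (abs_nonneg _) hp0).1 hi)

theorem vecLpNorm_smul {p : ℝ} (hp : 1 ≤ p) {n : ℕ} {s : ℝ} (hs : 0 ≤ s) (v : Fin n → ℝ) :
    vecLpNorm p (s • v) = s * vecLpNorm p v := by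
  have hp0 : p ≠ 0 := by positivity
  simp only [vecLpNorm, Pi.smul_apply, smul_eq_mul, abs_mul, abs_of_nonneg hs]
  simp_rw [Real.mul_rpow hs (abs_nonneg _)]
  rw [← Finset.mul_sum, Real.mul_rpow (by positivity) (by positivity), ← Real.rpow_mul hs,
    mul_one_div_cancel hp0, Real.rpow_one]

/-- The inequality of arithmetic and geometric means for the `α`-th powers of three numbers. -/
theorem mul_rpow_div_three_le {a b c : ℝ} (α : ℝ) (ha : 0 ≤ a) (hb : 0 ≤ b) (hc : 0 ≤ c) :
    (a * b * c) ^ (α / 3) ≤ 1 / 3 * (a ^ α + b ^ α + c ^ α) := by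
  have key := Real.geom_mean_le_arith_mean3_weighted (w₁ := 1 / 3) (w₂ := 1 / 3) (w₃ := 1 / 3)
    (by norm_num) (by norm_num) (by norm_num)
    (Real.rpow_nonneg ha α) (Real.rpow_nonneg hb α) (Real.rpow_nonneg hc α) (by norm_num)
  rw [← Real.rpow_mul ha, ← Real.rpow_mul hb, ← Real.rpow_mul hc, mul_one_div] at key
  rw [Real.mul_rpow (by positivity) hc, Real.mul_rpow ha hb]
  linarith

/-- Every rank-one tensor can be rewritten with three factors of equal norm. -/
theorem exists_balanced_factors {p α : ℝ} (hp : 1 ≤ p) (hα : 0 < α) {l m n : ℕ}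
    (x : Fin l → ℝ) (y : Fin m → ℝ) (z : Fin n → ℝ) :
    ∃ (x' : Fin l → ℝ) (y' : Fin m → ℝ) (z' : Fin n → ℝ),
      (∀ i j k, x' i * y' j * z' k = x i * y j * z k) ∧
      1 / 3 * (vecLpNorm p x' ^ α + vecLpNorm p y' ^ α + vecLpNorm p z' ^ α) =
        (vecLpNorm p x * vecLpNorm p y * vecLpNorm p z) ^ (α / 3) := by
  have ha := vecLpNorm_nonneg p x
  have hb := vecLpNorm_nonneg p y
  have hc := vecLpNorm_nonneg p z
  by_cases h : vecLpNorm p x * vecLpNorm p y * vecLpNorm p z = 0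
  · refine ⟨0, 0, 0, fun i j k => ?_, ?_⟩
    · rcases mul_eq_zero.1 h with h | h
      · rcases mul_eq_zero.1 h with h | h <;> simp [eq_zero_of_vecLpNorm_eq_zero hp h]
      · simp [eq_zero_of_vecLpNorm_eq_zero hp h]
    · rw [h, Real.zero_rpow (by positivity)]
      simp [vecLpNorm_zero hp, Real.zero_rpow hα.ne']
  · obtain ⟨⟨ha0, hb0⟩, hc0⟩ : (vecLpNorm p x ≠ 0 ∧ vecLpNorm p y ≠ 0) ∧ vecLpNorm p z ≠ 0 := by
      simpa only [mul_ne_zero_iff] using h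
    set a := vecLpNorm p x
    set b := vecLpNorm p y
    set c := vecLpNorm p z
    have habc : 0 ≤ a * b * c := by positivity
    set g := (a * b * c) ^ (1 / 3 : ℝ) with hg
    have hg0 : 0 ≤ g := by positivity
    have hg3 : g ^ 3 = a * b * c := by
      rw [hg, ← Real.rpow_natCast, ← Real.rpow_mul habc]
      norm_num
    have hgα : g ^ α = (a * b * c) ^ (α / 3) := by
      rw [hg, ← Real.rpow_mul habc, one_div_mul_eq_div]
    refine ⟨(g / a) • x, (g / b) • y, (g / c) • z, fun i j k => ?_, ?_⟩
    · have hs : g / a * (g / b) * (g / c) = 1 := by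
        field_simp
        linarith
      simp only [Pi.smul_apply, smul_eq_mul]
      linear_combination x i * y j * z k * hs
    · rw [vecLpNorm_smul hp (by positivity), vecLpNorm_smul hp (by positivity),
        vecLpNorm_smul hp (by positivity), div_mul_cancel₀ _ ha0, div_mul_cancel₀ _ hb0,
        div_mul_cancel₀ _ hc0, ← hgα]
      ring

theorem stmt_0 {N₁ N₂ N₃ R : ℕ} (hN₁ : 0 < N₁) (hN₂ : 0 < N₂) (hN₃ : 0 < N₃)
    (hR : 0 < R) (X : Fin N₁ × Fin N₂ × Fin N₃ → ℝ) (p α : ℝ) (hp : 1 ≤ p) (hα : 0 < α)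
    (hne : ∃ (u1 : Fin R → Fin N₁ → ℝ) (u2 : Fin R → Fin N₂ → ℝ)
      (u3 : Fin R → Fin N₃ → ℝ), IsCPDecomp X u1 u2 u3) :
    sInf {y : ℝ | ∃ (u1 : Fin R → Fin N₁ → ℝ) (u2 : Fin R → Fin N₂ → ℝ)
        (u3 : Fin R → Fin N₃ → ℝ), IsCPDecomp X u1 u2 u3 ∧
        y = (1 / 3) * ∑ r, (vecLpNorm p (u1 r) ^ α + vecLpNorm p (u2 r) ^ α
          + vecLpNorm p (u3 r) ^ α)} =
    sInf {y : ℝ | ∃ (u1 : Fin R → Fin N₁ → ℝ) (u2 : Fin R → Fin N₂ → ℝ)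
        (u3 : Fin R → Fin N₃ → ℝ), IsCPDecomp X u1 u2 u3 ∧
        y = ∑ r, (vecLpNorm p (u1 r) * vecLpNorm p (u2 r) * vecLpNorm p (u3 r)) ^ (α / 3)} := by
  obtain ⟨w1, w2, w3, hw⟩ := hne
  apply le_antisymm
  · refine le_csInf ⟨_, w1, w2, w3, hw, rfl⟩ ?_
    rintro _ ⟨u1, u2, u3, hu, rfl⟩
    choose v1 v2 v3 hprod hnorm using fun r =>
      exists_balanced_factors hp hα (u1 r) (u2 r) (u3 r)
    refine csInf_le ⟨0, ?_⟩ ⟨v1, v2, v3, fun i j k => ?_, ?_⟩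
    · rintro _ ⟨u1, u2, u3, -, rfl⟩
      exact mul_nonneg (by norm_num) (Finset.sum_nonneg fun r _ => add_nonneg (add_nonneg
        (Real.rpow_nonneg (vecLpNorm_nonneg p _) _) (Real.rpow_nonneg (vecLpNorm_nonneg p _) _))
        (Real.rpow_nonneg (vecLpNorm_nonneg p _) _))
    · simp_rw [hprod]
      exact hu i j k
    · simp_rw [Finset.mul_sum, hnorm]
  · refine le_csInf ⟨_, w1, w2, w3, hw, rfl⟩ ?_
    rintro _ ⟨u1, u2, u3, hu, rfl⟩
    refine csInf_le_of_le ⟨0, ?_⟩ ⟨u1, u2, u3, hu, rfl⟩ ?_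
    · rintro _ ⟨u1, u2, u3, -, rfl⟩
      exact Finset.sum_nonneg fun r _ => Real.rpow_nonneg (mul_nonneg (mul_nonneg
        (vecLpNorm_nonneg p _) (vecLpNorm_nonneg p _)) (vecLpNorm_nonneg p _)) _
    · rw [Finset.mul_sum]
      exact Finset.sum_le_sum fun r _ => mul_rpow_div_three_le α
        (vecLpNorm_nonneg p _) (vecLpNorm_nonneg p _) (vecLpNorm_nonneg p _)
end

section
/- Fix an integer d ≥ 2. For integer n ≥ 2, let K(n) = (n^d − n)/(n − 1) and mrr(n) = (n^d + n + K(n)/(n+1) + K(n)·n) / (n^d + n + (n+1)·K(n)). Then n·(1 − mrr(n)) tends to 1/2 as n → ∞; that is, 1 − mrr(n) is asymptotically equivalent to 1/(2n). -/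
open Filter

/-- Number of internal nodes of a complete `n`-ary tree of depth `d`. -/
noncomputable def treeK (d n : ℕ) : ℝ := ((n : ℝ) ^ d - n) / ((n : ℝ) - 1)

/-- Filtered MRR of DistMult on a single hierarchical predicate given by a complete
`n`-ary tree of depth `d`. -/
noncomputable def treeMRR (d n : ℕ) : ℝ :=
  ((n : ℝ) ^ d + n + treeK d n / ((n : ℝ) + 1) + treeK d n * n) /
    ((n : ℝ) ^ d + n + ((n : ℝ) + 1) * treeK d n)

theorem tendsto_div_add_one_atTop :
    Tendsto (fun x : ℝ => x / (x + 1)) atTop (nhds 1) := by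
  have h : Tendsto (fun x : ℝ => 1 - (x + 1)⁻¹) atTop (nhds (1 - 0)) :=
    (tendsto_inv_atTop_zero.comp (tendsto_atTop_add_const_right _ 1 tendsto_id)).const_sub 1
  rw [sub_zero] at h
  refine h.congr' ?_
  filter_upwards [eventually_gt_atTop 0] with x hx
  field_simp
  ring

theorem le_treeK {d n : ℕ} (hd : 2 ≤ d) (hn : 2 ≤ n) : (n : ℝ) ≤ treeK d n := by
  have hn' : (2 : ℝ) ≤ n := by exact_mod_cast hn
  have hpow : (n : ℝ) ^ 2 ≤ (n : ℝ) ^ d := pow_le_pow_right₀ (by linarith) hd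
  rw [treeK, le_div_iff₀ (by linarith)]
  linarith

theorem tendsto_treeK_atTop {d : ℕ} (hd : 2 ≤ d) : Tendsto (treeK d) atTop atTop :=
  tendsto_atTop_mono' _ ((eventually_ge_atTop 2).mono fun _ hn => le_treeK hd hn)
    tendsto_natCast_atTop_atTop

theorem natCast_mul_one_sub_treeMRR {d n : ℕ} (hd : 2 ≤ d) (hn : 2 ≤ n) :
    (n : ℝ) * (1 - treeMRR d n) =
      1 / 2 * ((n : ℝ) / (n + 1)) * (treeK d n / (treeK d n + 1)) := by
  have hn' : (2 : ℝ) ≤ n := by exact_mod_cast hn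
  have hK := le_treeK hd hn
  have hpow : (n : ℝ) ^ d = (n - 1) * treeK d n + n := by
    rw [treeK, mul_div_cancel₀ _ (by linarith : (n : ℝ) - 1 ≠ 0)]
    ring
  have hden : (n : ℝ) ^ d + n + (n + 1) * treeK d n = 2 * n * (treeK d n + 1) := by
    rw [hpow]
    ring
  rw [treeMRR, hden, hpow]
  have hK1 : treeK d n + 1 ≠ 0 := by linarith
  have hn1 : (n : ℝ) + 1 ≠ 0 := by linarith
  have hn0 : (n : ℝ) ≠ 0 := by linarith
  field_simp
  ring

theorem stmt_12 (d : ℕ) (hd : 2 ≤ d) :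
    Tendsto (fun n : ℕ => (n : ℝ) * (1 - treeMRR d n)) atTop (nhds (1 / 2)) := by
  have hn := tendsto_div_add_one_atTop.comp (tendsto_natCast_atTop_atTop (R := ℝ))
  have hK := tendsto_div_add_one_atTop.comp (tendsto_treeK_atTop hd)
  have h := (hn.const_mul (1 / 2)).mul hK
  rw [mul_one, mul_one] at h
  refine h.congr' ?_
  filter_upwards [eventually_ge_atTop 2] with n hn
  exact (natCast_mul_one_sub_treeMRR hd hn).symm
end

section
/- Let σ ∈ ℝ^R with σ_r ≥ 0 for all r, let u_r, v_r ∈ ℝ² be unit vectors (‖u_r‖₂ = ‖v_r‖₂ = 1), and suppose A = Σ_{r=1}^R σ_r · u_r v_rᵀ where A = (1/2)·I₂ is half the 2×2 identity matrix. Then ‖σ‖_{2/3} := (Σ_r σ_r^{2/3})^{3/2} > 1. -/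
open Finset

/-- The vector ℓ₂ (Euclidean) norm on `ℝ^n`. -/
noncomputable def vecL2Norm {n : ℕ} (v : Fin n → ℝ) : ℝ :=
  (∑ i, (v i) ^ 2) ^ ((1 : ℝ) / 2)

lemma sum_sq_eq_one_of_vecL2Norm_eq_one {n : ℕ} {v : Fin n → ℝ} (h : vecL2Norm v = 1) :
    ∑ i, v i ^ 2 = 1 := by
  rw [vecL2Norm, ← Real.sqrt_eq_rpow] at h
  exact Real.sqrt_eq_one.mp h

/-- A nonnegative family with `∑ σ ≥ 1` whose `p`-th powers, `0 < p < 1`, sum to at most `1` has a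
single nonzero entry. -/
lemma exists_forall_ne_eq_zero_of_sum_rpow_le_one {ι : Type*} [Fintype ι] {σ : ι → ℝ} {p : ℝ}
    (hp : 0 < p) (hp1 : p < 1) (hσ : ∀ r, 0 ≤ σ r) (h1 : 1 ≤ ∑ r, σ r)
    (hS : ∑ r, σ r ^ p ≤ 1) : ∃ r, ∀ s, s ≠ r → σ s = 0 := by
  have hnn : ∀ r, 0 ≤ σ r ^ p := fun r => Real.rpow_nonneg (hσ r) _
  by_cases hlt : ∀ r, σ r < 1
  · have hle : ∀ r, σ r ≤ σ r ^ p := fun r =>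
      Real.self_le_rpow_of_le_one (hσ r) (hlt r).le hp1.le
    obtain ⟨r, -, hr⟩ : ∃ r ∈ univ, 0 < σ r :=
      exists_lt_of_sum_lt (by simpa using zero_lt_one.trans_le h1)
    have := Finset.sum_lt_sum (fun r _ => hle r)
      ⟨r, mem_univ r, Real.self_lt_rpow_of_lt_one hr (hlt r) hp1⟩
    linarith
  · push Not at hlt
    obtain ⟨r, hr⟩ := hlt
    refine ⟨r, fun s hs => ?_⟩
    have hr' : 1 ≤ σ r ^ p := Real.one_le_rpow hr hp.le
    have := Finset.add_le_sum (fun i _ => hnn i) (mem_univ r) (mem_univ s) hs.symm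
    have hs0 : σ s ^ p = 0 := le_antisymm (by linarith) (hnn s)
    exact (Real.rpow_eq_zero (hσ s) hp.ne').mp hs0

theorem stmt_14 {R : ℕ} (σ : Fin R → ℝ) (hσ : ∀ r, 0 ≤ σ r)
    (u v : Fin R → Fin 2 → ℝ)
    (hu : ∀ r, vecL2Norm (u r) = 1) (hv : ∀ r, vecL2Norm (v r) = 1)
    (hA : (1 / 2 : ℝ) • (1 : Matrix (Fin 2) (Fin 2) ℝ) =
      ∑ r, σ r • Matrix.of (fun i j => u r i * v r j)) :
    1 < (∑ r, σ r ^ ((2 : ℝ) / 3)) ^ ((3 : ℝ) / 2) := by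
  refine Real.one_lt_rpow ?_ (by norm_num)
  have entry : ∀ i j, (1 / 2 : ℝ) * (1 : Matrix (Fin 2) (Fin 2) ℝ) i j =
      ∑ r, σ r * (u r i * v r j) := fun i j => by
    simpa [Matrix.sum_apply] using congrFun (congrFun hA i) j
  have h00 := entry 0 0
  have h01 := entry 0 1
  have h10 := entry 1 0
  have h11 := entry 1 1
  simp only [Matrix.one_apply, Fin.isValue, if_true, zero_ne_one, one_ne_zero, if_false, mul_one,
    mul_zero] at h00 h01 h10 h11
  have hsum : 1 ≤ ∑ r, σ r := by
    calc (1 : ℝ) = ∑ r, σ r * (u r 0 * v r 0 + u r 1 * v r 1) := by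
          simp only [mul_add, sum_add_distrib]
          linarith
      _ ≤ ∑ r, σ r := by
          refine sum_le_sum fun r _ => mul_le_of_le_one_right (hσ r) ?_
          have hu' := sum_sq_eq_one_of_vecL2Norm_eq_one (hu r)
          have hv' := sum_sq_eq_one_of_vecL2Norm_eq_one (hv r)
          rw [Fin.sum_univ_two] at hu' hv'
          nlinarith [sq_nonneg (u r 0 - v r 0), sq_nonneg (u r 1 - v r 1)]
  by_contra! hS
  obtain ⟨r, hr⟩ := exists_forall_ne_eq_zero_of_sum_rpow_le_one (by norm_num) (by norm_num)
    hσ hsum hS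
  have single : ∀ i j, ∑ s, σ s * (u s i * v s j) = σ r * (u r i * v r j) := fun i j =>
    Fintype.sum_eq_single r fun s hs => by rw [hr s hs, zero_mul]
  rw [single] at h00 h01 h10 h11
  have hdet : (1 / 2 : ℝ) * (1 / 2) = 0 * 0 := by
    calc (1 / 2 : ℝ) * (1 / 2)
        = (σ r * (u r 0 * v r 0)) * (σ r * (u r 1 * v r 1)) := by rw [← h00, ← h11]
      _ = (σ r * (u r 0 * v r 1)) * (σ r * (u r 1 * v r 0)) := by ring
      _ = 0 * 0 := by rw [← h01, ← h10]
  norm_num at hdet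
end
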